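/- Every tensor Ψ ∈ ℂ^{I₁}⊗⋯⊗ℂ^{I_N} admits a HOSVD: there exist unitary matrices U⁽¹⁾, …, U⁽ᴺ⁾ and an all-orthogonal tensor Σ with ordered mode-n singular values such that Ψ = (⊗ₙ U⁽ⁿ⁾)Σ. -/

import Mathlib

open Matrix BigOperators

noncomputable section

/-- The full Kronecker (tensor) product `⊗ₙ U⁽ⁿ⁾` of the local matrices, as a matrix
on the product index set. -/
def kronFull {N : ℕ} {I : Fin N → ℕ} (U : ∀ n, Matrix (Fin (I n)) (Fin (I n)) ℂ) :
    Matrix (∀ n, Fin (I n)) (∀ n, Fin (I n)) ℂ :=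
  Matrix.of fun x y => ∏ n, U n (x n) (y n)

/-- The action of a local operator `⊗ₙ U⁽ⁿ⁾` on a tensor `T ∈ ℂ^{I₁}⊗⋯⊗ℂ^{I_N}`. -/
def locAct {N : ℕ} {I : Fin N → ℕ} (U : ∀ n, Matrix (Fin (I n)) (Fin (I n)) ℂ)
    (T : (∀ n, Fin (I n)) → ℂ) : (∀ n, Fin (I n)) → ℂ :=
  fun x => ∑ y : ∀ n, Fin (I n), (∏ n, U n (x n) (y n)) * T y

/-- Assemble a full multi-index from the value `i` of the `n`-th index and the values
`c` of the remaining indices. -/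
def assemble {N : ℕ} {I : Fin N → ℕ} (n : Fin N) (i : Fin (I n))
    (c : ∀ k : {k : Fin N // k ≠ n}, Fin (I k.1)) : ∀ m, Fin (I m) :=
  fun m => if h : m = n then cast (show Fin (I n) = Fin (I m) by rw [h]) i else c ⟨m, h⟩

/-- The mode-`n` matrix unfolding of a tensor (columns indexed by the remaining indices). -/
def unfold {N : ℕ} {I : Fin N → ℕ} (n : Fin N) (T : (∀ m, Fin (I m)) → ℂ) :
    Matrix (Fin (I n)) (∀ k : {k : Fin N // k ≠ n}, Fin (I k.1)) ℂ :=
  Matrix.of fun i c => T (assemble n i c)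

/-- The Hermitian inner product `⟨T_{i_n=i}, T'_{i_n=j}⟩` of mode-`n` slices. -/
def modeInner {N : ℕ} {I : Fin N → ℕ} (n : Fin N) (T T' : (∀ m, Fin (I m)) → ℂ)
    (i j : Fin (I n)) : ℂ :=
  ∑ c : ∀ k : {k : Fin N // k ≠ n}, Fin (I k.1),
    star (T (assemble n i c)) * T' (assemble n j c)

/-- `T` is all-orthogonal with ordered mode-`n` singular values `σ n`. -/
def AllOrth {N : ℕ} {I : Fin N → ℕ} (σ : ∀ n, Fin (I n) → ℝ)
    (T : (∀ m, Fin (I m)) → ℂ) : Prop :=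
  (∀ n, Antitone (σ n)) ∧ (∀ n i, 0 ≤ σ n i) ∧
    ∀ n i j, modeInner n T T i j = if i = j then ((σ n i : ℂ)) ^ 2 else 0

/-- Squared Frobenius norm of a tensor. -/
def fnormSq {N : ℕ} {I : Fin N → ℕ} (T : (∀ m, Fin (I m)) → ℂ) : ℝ :=
  ∑ x, Complex.normSq (T x)

open scoped ComplexOrder in
/-- The Gram matrix `A * Aᴴ` is unitarily diagonalized by squares of nonnegative reals
in decreasing order. -/
theorem exists_unitary_antitone_diagonal {k : ℕ} {m : Type*} [Fintype m]
    (A : Matrix (Fin k) m ℂ) :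
    ∃ V ∈ Matrix.unitaryGroup (Fin k) ℂ, ∃ σ : Fin k → ℝ, Antitone σ ∧ (∀ i, 0 ≤ σ i) ∧
      Vᴴ * (A * Aᴴ) * V = diagonal fun i => (σ i : ℂ) ^ 2 := by
  have hM := Matrix.posSemidef_self_mul_conjTranspose A
  generalize A * Aᴴ = M at hM ⊢
  set E := hM.isHermitian.eigenvectorUnitary
  set e := hM.isHermitian.eigenvalues
  set p := Tuple.sort fun i => -e i
  have hp : Antitone (e ∘ p) := fun i j hij =>
    neg_le_neg_iff.mp (Tuple.monotone_sort (fun i => -e i) hij)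
  have hE : (E : Matrix (Fin k) (Fin k) ℂ)ᴴ * E = 1 := Unitary.coe_star_mul_self E
  have hd : (E : Matrix (Fin k) (Fin k) ℂ)ᴴ * M * E = diagonal fun i => (e i : ℂ) := by
    have h := hM.isHermitian.conjStarAlgAut_star_eigenvectorUnitary
    rw [Unitary.conjStarAlgAut_star_apply] at h
    exact h
  refine ⟨(E : Matrix (Fin k) (Fin k) ℂ).submatrix id p, ?_, fun i => √(e (p i)),
    fun i j hij => Real.sqrt_le_sqrt (hp hij), fun i => Real.sqrt_nonneg _, ?_⟩
  · rw [Matrix.mem_unitaryGroup_iff', star_eq_conjTranspose, conjTranspose_submatrix,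
      ← submatrix_mul _ _ _ _ _ Function.bijective_id, hE, submatrix_one_equiv]
  · have hs : (M : Matrix (Fin k) (Fin k) ℂ) = M.submatrix id id := rfl
    rw [hs, conjTranspose_submatrix, ← submatrix_mul _ _ _ _ _ Function.bijective_id,
      ← submatrix_mul _ _ _ _ _ Function.bijective_id, hd, submatrix_diagonal_equiv]
    congr 1
    funext i
    have h : √(e (p i)) ^ 2 = e (p i) := Real.sq_sqrt (hM.eigenvalues_nonneg _)
    simp only [Function.comp_apply]
    exact_mod_cast h.symm

/-- The Kronecker product of a family of square matrices. -/
def piKronecker {ι : Type*} [Fintype ι] {κ : ι → Type*}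
    (U : ∀ k, Matrix (κ k) (κ k) ℂ) : Matrix (∀ k, κ k) (∀ k, κ k) ℂ :=
  Matrix.of fun x y => ∏ k, U k (x k) (y k)

section piKronecker

variable {ι : Type*} [Fintype ι] {κ : ι → Type*}

theorem piKronecker_mul [DecidableEq ι] [∀ k, Fintype (κ k)]
    (U V : ∀ k, Matrix (κ k) (κ k) ℂ) :
    piKronecker U * piKronecker V = piKronecker fun k => U k * V k := by
  ext x z
  simp only [piKronecker, Matrix.mul_apply, Matrix.of_apply, ← Finset.prod_mul_distrib,
    Fintype.prod_sum]

theorem piKronecker_one [∀ k, DecidableEq (κ k)] :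
    piKronecker (fun k => (1 : Matrix (κ k) (κ k) ℂ)) = 1 := by
  ext x y
  simp [piKronecker, Matrix.one_apply, Fintype.prod_ite_zero, funext_iff]

theorem piKronecker_conjTranspose (U : ∀ k, Matrix (κ k) (κ k) ℂ) :
    (piKronecker U)ᴴ = piKronecker fun k => (U k)ᴴ := by
  ext x y
  simp [piKronecker, Matrix.conjTranspose_apply]

end piKronecker

section

variable {N : ℕ} {I : Fin N → ℕ}

theorem locAct_eq_mulVec (U : ∀ n, Matrix (Fin (I n)) (Fin (I n)) ℂ)
    (T : (∀ n, Fin (I n)) → ℂ) : locAct U T = piKronecker U *ᵥ T :=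
  rfl

theorem assemble_eq_piSplitAt_symm (n : Fin N) (i : Fin (I n))
    (c : ∀ k : {k : Fin N // k ≠ n}, Fin (I k.1)) :
    assemble n i c = (Equiv.piSplitAt n fun m => Fin (I m)).symm (i, c) := by
  funext m
  by_cases h : m = n
  · subst h
    simp [assemble, Equiv.piSplitAt]
  · simp [assemble, Equiv.piSplitAt, h]

theorem assemble_self (n : Fin N) (i : Fin (I n))
    (c : ∀ k : {k : Fin N // k ≠ n}, Fin (I k.1)) : assemble n i c n = i := by
  simp [assemble]

theorem assemble_subtype_ne (n : Fin N) (i : Fin (I n))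
    (c : ∀ k : {k : Fin N // k ≠ n}, Fin (I k.1)) (k : {k : Fin N // k ≠ n}) :
    assemble n i c k.1 = c k := by
  simp [assemble, k.2]

theorem unfold_locAct (n : Fin N) (U : ∀ n, Matrix (Fin (I n)) (Fin (I n)) ℂ)
    (T : (∀ n, Fin (I n)) → ℂ) :
    unfold n (locAct U T) =
      U n * (unfold n T * (piKronecker fun k : {k : Fin N // k ≠ n} => U k.1)ᵀ) := by
  ext i c
  simp only [unfold, locAct, Matrix.of_apply, Matrix.mul_apply, Finset.mul_sum, piKronecker,
    Matrix.transpose_apply]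
  rw [← (Equiv.piSplitAt n fun m => Fin (I m)).symm.sum_comp, Fintype.sum_prod_type]
  refine Finset.sum_congr rfl fun j _ => Finset.sum_congr rfl fun d _ => ?_
  rw [← assemble_eq_piSplitAt_symm, Fintype.prod_eq_mul_prod_subtype_ne _ n]
  simp only [assemble_self, assemble_subtype_ne]
  ring

theorem modeInner_eq_unfold (n : Fin N) (T T' : (∀ m, Fin (I m)) → ℂ) (i j : Fin (I n)) :
    modeInner n T T' i j = (unfold n T' * (unfold n T)ᴴ) j i := by
  simp [modeInner, unfold, Matrix.mul_apply, mul_comm]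

/-- Unitaries acting on the other modes do not affect the mode-`n` Gram matrix. -/
theorem unfold_locAct_mul_conjTranspose (n : Fin N) (U : ∀ n, Matrix (Fin (I n)) (Fin (I n)) ℂ)
    (hU : ∀ n, U n ∈ Matrix.unitaryGroup (Fin (I n)) ℂ) (T : (∀ n, Fin (I n)) → ℂ) :
    unfold n (locAct U T) * (unfold n (locAct U T))ᴴ =
      U n * (unfold n T * (unfold n T)ᴴ) * (U n)ᴴ := by
  set K := piKronecker fun k : {k : Fin N // k ≠ n} => U k.1 with hK
  have h1 : Kᴴ * K = 1 := by
    rw [hK, piKronecker_conjTranspose, piKronecker_mul, ← piKronecker_one]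
    congr 1
    funext k
    exact Matrix.mem_unitaryGroup_iff'.mp (hU k.1)
  have h2 : Kᵀ * Kᵀᴴ = 1 := by
    rw [show Kᵀᴴ = Kᴴᵀ from rfl, ← Matrix.transpose_mul, h1, Matrix.transpose_one]
  rw [unfold_locAct, ← hK, Matrix.conjTranspose_mul, Matrix.conjTranspose_mul]
  calc U n * (unfold n T * Kᵀ) * (Kᵀᴴ * (unfold n T)ᴴ * (U n)ᴴ)
      = U n * (unfold n T * (Kᵀ * Kᵀᴴ) * (unfold n T)ᴴ) * (U n)ᴴ := by
        simp only [Matrix.mul_assoc]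
    _ = _ := by rw [h2, Matrix.mul_one]

end

/-- Every tensor admits a HOSVD: unitaries `U⁽ⁿ⁾` and an all-orthogonal core
tensor `Σ` with ordered mode-`n` singular values such that `Ψ = (⊗ₙ U⁽ⁿ⁾)Σ`. -/
theorem stmt10 {N : ℕ} {I : Fin N → ℕ} (Ψ : (∀ n, Fin (I n)) → ℂ) :
    ∃ (U : ∀ n, Matrix (Fin (I n)) (Fin (I n)) ℂ) (σ : ∀ n, Fin (I n) → ℝ)
      (T : (∀ n, Fin (I n)) → ℂ),
      (∀ n, U n ∈ Matrix.unitaryGroup (Fin (I n)) ℂ) ∧ AllOrth σ T ∧ Ψ = locAct U T := by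
  choose V hV σ hanti hnn hdiag using fun n =>
    exists_unitary_antitone_diagonal (unfold n Ψ)
  have hVstar : ∀ n, (V n)ᴴ ∈ Matrix.unitaryGroup (Fin (I n)) ℂ := fun n =>
    Unitary.star_mem (hV n)
  refine ⟨V, σ, locAct (fun n => (V n)ᴴ) Ψ, hV, ⟨hanti, hnn, fun n i j => ?_⟩, ?_⟩
  · rw [modeInner_eq_unfold, unfold_locAct_mul_conjTranspose n _ hVstar,
      Matrix.conjTranspose_conjTranspose, hdiag, Matrix.diagonal_apply]
    by_cases h : i = j
    · simp [h]
    · simp [h, Ne.symm h]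
  · have h : (fun n => V n * (V n)ᴴ) = fun _ => 1 :=
      funext fun n => Matrix.mem_unitaryGroup_iff.mp (hV n)
    rw [locAct_eq_mulVec, locAct_eq_mulVec, Matrix.mulVec_mulVec, piKronecker_mul, h,
      piKronecker_one, Matrix.one_mulVec]
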